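/- Solutions of a linear ODE with coefficients in 𝔤 stay in the group G: if A : ℝ → M_{2n}(ℝ) is continuous with A(t) ∈ 𝔤 for all t, and ψ : ℝ → M_{2n}(ℝ) is differentiable with ψ(0) = I_{2n} and ψ'(t) = A(t)·ψ(t) for all t, then ψ(t) ∈ G for every t ∈ ℝ. -/

import Mathlib

open Matrix

/-- The standard symplectic matrix `J_{2k}`. -/
def Jstd (k : ℕ) : Matrix (Fin (2 * k)) (Fin (2 * k)) ℝ :=
  Matrix.of fun i j =>
    if i.val = j.val + 1 ∧ j.val % 2 = 0 then 1
    else if j.val = i.val + 1 ∧ i.val % 2 = 0 then -1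
    else 0

/-- The interleaved vector `(X₁, Y₁, …, X_m, Y_m)` in `ℝ^{2m}`. -/
def interleave (m : ℕ) (X Y : Fin m → ℝ) : Fin (2 * m) → ℝ :=
  fun i =>
    if i.val % 2 = 0 then X ⟨i.val / 2, by have := i.isLt; omega⟩
    else Y ⟨i.val / 2, by have := i.isLt; omega⟩

/-- The `(2m) × 2` block with prescribed first column and zero second column. -/
def colB (m : ℕ) (x : Fin (2 * m) → ℝ) : Matrix (Fin (2 * m)) (Fin 2) ℝ :=
  Matrix.of fun i j => if j = 0 then x i else 0

/-- The `2 × (2m)` block with zero first row and prescribed second row. -/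
def rowC (m : ℕ) (w : Fin (2 * m) → ℝ) : Matrix (Fin 2) (Fin (2 * m)) ℝ :=
  Matrix.of fun i j => if i = 1 then w j else 0

/-- The Lie algebra `𝔤` of block matrices `[[R,B],[C,D]]` with `R ∈ sp(2m, ℝ)`, `B` having
first column `(X₁,Y₁,…)ᵀ` and second column `0`, `C` having first row `0` and second row
`(Y₁,−X₁,…)`, and `D = [[a,0],[b,−a]]`. -/
def gSet (m : ℕ) : Set (Matrix (Fin (2 * m) ⊕ Fin 2) (Fin (2 * m) ⊕ Fin 2) ℝ) :=
  { A | ∃ (R : Matrix (Fin (2 * m)) (Fin (2 * m)) ℝ) (X Y : Fin m → ℝ) (a b : ℝ),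
      Rᵀ * Jstd m + Jstd m * R = 0 ∧
      A = Matrix.fromBlocks R (colB m (interleave m X Y))
            (rowC m (interleave m Y fun t => -X t)) !![a, 0; b, -a] }

/-- The group `G` of block matrices `[[M,B],[C,D]]` with `M ∈ Sp(2m, ℝ)`, `B` having first
column `x = (x₁,y₁,…)ᵀ` and second column `0`, `C` having first row `0` and second row
`w = (u₁,v₁,…)`, `D = [[α,0],[β,α⁻¹]]` with `α > 0`, subject to
`(−y₁,x₁,…,−y_m,x_m)·M + α·w = 0`. -/
def GSet (m : ℕ) : Set (Matrix (Fin (2 * m) ⊕ Fin 2) (Fin (2 * m) ⊕ Fin 2) ℝ) :=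
  { ψ | ∃ (M : Matrix (Fin (2 * m)) (Fin (2 * m)) ℝ) (X Y U V : Fin m → ℝ) (α β : ℝ),
      Mᵀ * Jstd m * M = Jstd m ∧ 0 < α ∧
      Matrix.vecMul (interleave m (fun t => -Y t) X) M + α • interleave m U V = 0 ∧
      ψ = Matrix.fromBlocks M (colB m (interleave m X Y))
            (rowC m (interleave m U V)) !![α, 0; β, α⁻¹] }

/-- The partner index in the symplectic pairing. -/
def jpart (m : ℕ) (i : Fin (2 * m)) : Fin (2 * m) :=
  if h : i.val % 2 = 0 then ⟨i.val + 1, by have := i.isLt; omega⟩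
  else ⟨i.val - 1, by have := i.isLt; omega⟩

/-- The sign in the symplectic pairing. -/
def jsgn (m : ℕ) (i : Fin (2 * m)) : ℝ := if i.val % 2 = 0 then -1 else 1

theorem jpart_val_even (m : ℕ) (i : Fin (2 * m)) (h : i.val % 2 = 0) :
    (jpart m i).val = i.val + 1 := by
  unfold jpart
  rw [dif_pos h]

theorem jpart_val_odd (m : ℕ) (i : Fin (2 * m)) (h : ¬ i.val % 2 = 0) :
    (jpart m i).val = i.val - 1 := by
  unfold jpart
  rw [dif_neg h]

theorem Jstd_apply (m : ℕ) (i j : Fin (2 * m)) :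
    Jstd m i j = if j = jpart m i then jsgn m i else 0 := by
  unfold Jstd jsgn
  simp only [Matrix.of_apply, Fin.ext_iff]
  by_cases h : i.val % 2 = 0
  · rw [jpart_val_even m i h]
    split_ifs <;> first | rfl | (exfalso; omega)
  · rw [jpart_val_odd m i h]
    split_ifs <;> first | rfl | (exfalso; omega)

theorem Jstd_transpose (m : ℕ) : (Jstd m)ᵀ = - Jstd m := by
  ext i j
  unfold Jstd
  simp only [Matrix.transpose_apply, Matrix.neg_apply, Matrix.of_apply]
  split_ifs <;> first | (exfalso; omega) | norm_num

theorem jpart_jpart (m : ℕ) (i : Fin (2 * m)) : jpart m (jpart m i) = i := by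
  apply Fin.ext
  by_cases h : i.val % 2 = 0
  · have h1 := jpart_val_even m i h
    rw [jpart_val_odd m (jpart m i) (by omega)]
    omega
  · have h1 := jpart_val_odd m i h
    rw [jpart_val_even m (jpart m i) (by omega)]
    omega

theorem jsgn_jpart (m : ℕ) (i : Fin (2 * m)) : jsgn m i * jsgn m (jpart m i) = -1 := by
  unfold jsgn
  by_cases h : i.val % 2 = 0
  · have h1 := jpart_val_even m i h
    rw [if_pos h, if_neg (by omega)]
    norm_num
  · have h1 := jpart_val_odd m i h
    rw [if_neg h, if_pos (by omega)]
    norm_num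

theorem Jstd_mulVec (m : ℕ) (v : Fin (2 * m) → ℝ) (i : Fin (2 * m)) :
    ∑ k, Jstd m i k * v k = jsgn m i * v (jpart m i) := by
  simp [Jstd_apply]

theorem Jstd_sq (m : ℕ) : Jstd m * Jstd m = -1 := by
  ext i j
  rw [Matrix.mul_apply, Jstd_mulVec m (fun k => Jstd m k j), Jstd_apply, jpart_jpart]
  by_cases h : j = i
  · subst h; simp [jsgn_jpart]
  · simp [h, Matrix.one_apply, Ne.symm h]

theorem Jstd_interleave (m : ℕ) (X Y : Fin m → ℝ) (i : Fin (2 * m)) :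
    jsgn m i * interleave m X Y (jpart m i) = interleave m (fun t => - Y t) X i := by
  unfold jsgn interleave
  by_cases h : i.val % 2 = 0
  · have h1 := jpart_val_even m i h
    rw [if_pos h, if_neg (by omega), if_pos h, neg_one_mul]
    congr 2
    apply Fin.ext
    simp only
    omega
  · have h1 := jpart_val_odd m i h
    rw [if_neg h, if_pos (by omega), if_neg h, one_mul]
    congr 1
    apply Fin.ext
    simp only
    omega

theorem exists_interleave (m : ℕ) (v : Fin (2 * m) → ℝ) :
    ∃ X Y : Fin m → ℝ, v = interleave m X Y := by
  refine ⟨fun t => v ⟨2 * t.val, by have := t.isLt; omega⟩,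
    fun t => v ⟨2 * t.val + 1, by have := t.isLt; omega⟩, ?_⟩
  funext i
  unfold interleave
  split_ifs <;> congr 1 <;> apply Fin.ext <;> simp <;> omega

/-- The full symplectic form. -/
def Kfull (m : ℕ) : Matrix (Fin (2 * m) ⊕ Fin 2) (Fin (2 * m) ⊕ Fin 2) ℝ :=
  Matrix.fromBlocks (Jstd m) 0 0 !![0, -1; 1, 0]

theorem Kfull_sq (m : ℕ) : Kfull m * Kfull m = -1 := by
  unfold Kfull
  rw [Matrix.fromBlocks_multiply, ← Matrix.fromBlocks_one, Matrix.fromBlocks_neg]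
  congr 1
  · simp [Jstd_sq]
  · simp
  · simp
  · ext i j; fin_cases i <;> fin_cases j <;> simp

theorem g_infinitesimal (m : ℕ) (A : Matrix (Fin (2 * m) ⊕ Fin 2) (Fin (2 * m) ⊕ Fin 2) ℝ)
    (hA : A ∈ gSet m) : Aᵀ * Kfull m + Kfull m * A = 0 := by
  obtain ⟨R, X, Y, a, b, hR, rfl⟩ := hA
  have key : ∀ i, interleave m Y (fun t => - X t) i
      + jsgn m i * interleave m X Y (jpart m i) = 0 := by
    intro i
    rw [Jstd_interleave]
    unfold interleave
    split_ifs <;> simp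
  have h12 : (rowC m (interleave m Y fun t => -X t))ᵀ * (!![0, -1; 1, 0] : Matrix (Fin 2) (Fin 2) ℝ)
      + Jstd m * colB m (interleave m X Y) = 0 := by
    ext i j
    fin_cases j
    · simpa [Matrix.mul_apply, rowC, colB, Jstd_mulVec] using key i
    · simp [Matrix.mul_apply, rowC, colB]
  have h21 : (colB m (interleave m X Y))ᵀ * Jstd m
      + (!![0, -1; 1, 0] : Matrix (Fin 2) (Fin 2) ℝ) * rowC m (interleave m Y fun t => -X t) = 0 := by
    have h := congrArg Matrix.transpose h12
    simp only [Matrix.transpose_add, Matrix.transpose_mul, Matrix.transpose_transpose,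
      Jstd_transpose, Matrix.transpose_zero] at h
    have e : (!![0, -1; 1, 0] : Matrix (Fin 2) (Fin 2) ℝ)ᵀ = - !![0, -1; 1, 0] := by
      ext i j; fin_cases i <;> fin_cases j <;> simp
    rw [e, Matrix.neg_mul, Matrix.mul_neg, ← neg_add, neg_eq_zero, add_comm] at h
    exact h
  unfold Kfull
  rw [Matrix.fromBlocks_transpose, Matrix.fromBlocks_multiply, Matrix.fromBlocks_multiply,
    Matrix.fromBlocks_add, ← Matrix.fromBlocks_zero]
  simp only [Matrix.mul_zero, Matrix.zero_mul, add_zero, zero_add]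
  rw [hR, h12, h21]
  congr 1
  ext i j; fin_cases i <;> fin_cases j <;> simp [Matrix.mul_apply, Fin.sum_univ_two]

theorem hasDerivAt_mul_entry {ι : Type*} [Fintype ι] (F G : ℝ → Matrix ι ι ℝ)
    (F' G' : Matrix ι ι ℝ) (t : ℝ)
    (hF : ∀ i j, HasDerivAt (fun s => F s i j) (F' i j) t)
    (hG : ∀ i j, HasDerivAt (fun s => G s i j) (G' i j) t) (i j : ι) :
    HasDerivAt (fun s => (F s * G s) i j) ((F' * G t + F t * G') i j) t := by
  simp only [Matrix.add_apply, Matrix.mul_apply, ← Finset.sum_add_distrib]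
  exact HasDerivAt.fun_sum fun k _ => (hF i k).mul (hG k j)

theorem symp_preserved {ι : Type*} [Fintype ι] [DecidableEq ι] (K : Matrix ι ι ℝ)
    (A ψ : ℝ → Matrix ι ι ℝ) (hA : ∀ t, (A t)ᵀ * K + K * A t = 0) (h0 : ψ 0 = 1)
    (hd : ∀ (t : ℝ) i j, HasDerivAt (fun s => ψ s i j) ((A t * ψ t) i j) t) (t : ℝ) :
    (ψ t)ᵀ * K * ψ t = K := by
  have h1 : ∀ (t : ℝ) i j, HasDerivAt (fun s => ((ψ s)ᵀ * K * ψ s) i j) 0 t := by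
    intro t i j
    have hT : ∀ i j, HasDerivAt (fun s => (ψ s)ᵀ i j) (((A t * ψ t)ᵀ) i j) t :=
      fun i j => hd t j i
    have hK : ∀ i j, HasDerivAt (fun _ : ℝ => K i j) ((0 : Matrix ι ι ℝ) i j) t :=
      fun i j => hasDerivAt_const _ _
    have h2 := hasDerivAt_mul_entry (fun s => (ψ s)ᵀ) (fun _ => K) _ _ t hT hK
    have h3 := hasDerivAt_mul_entry (fun s => (ψ s)ᵀ * K) ψ _ _ t h2 (hd t) i j
    have e : ((A t * ψ t)ᵀ * K + (ψ t)ᵀ * 0) * ψ t + (ψ t)ᵀ * K * (A t * ψ t) = 0 := by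
      have : ((A t * ψ t)ᵀ * K + (ψ t)ᵀ * 0) * ψ t + (ψ t)ᵀ * K * (A t * ψ t)
          = (ψ t)ᵀ * ((A t)ᵀ * K + K * A t) * ψ t := by
        rw [Matrix.transpose_mul]; noncomm_ring
      rw [this, hA]; simp
    rw [e] at h3
    exact h3
  ext i j
  have := is_const_of_deriv_eq_zero (f := fun s => ((ψ s)ᵀ * K * ψ s) i j)
    (fun s => (h1 s i j).differentiableAt) (fun s => (h1 s i j).deriv) t 0
  simpa [h0] using this

theorem scalar_ode (a r : ℝ → ℝ) (ha : Continuous a)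
    (hr : ∀ t, HasDerivAt r (a t * r t) t) (t : ℝ) :
    r t = r 0 * Real.exp (∫ s in (0 : ℝ)..t, a s) := by
  have hI : ∀ t, HasDerivAt (fun u => ∫ s in (0 : ℝ)..u, a s) (a t) t := fun t =>
    intervalIntegral.integral_hasDerivAt_right (ha.intervalIntegrable _ _)
      ha.aestronglyMeasurable.stronglyMeasurableAtFilter ha.continuousAt
  have h1 : ∀ t, HasDerivAt (fun u => r u * Real.exp (-∫ s in (0 : ℝ)..u, a s)) 0 t := by
    intro t
    have h := HasDerivAt.fun_mul (hr t) (hI t).fun_neg.exp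
    refine h.congr_deriv ?_
    ring
  have := is_const_of_deriv_eq_zero
    (f := fun u => r u * Real.exp (-∫ s in (0 : ℝ)..u, a s))
    (fun s => (h1 s).differentiableAt) (fun s => (h1 s).deriv) t 0
  simp only [intervalIntegral.integral_same, neg_zero, Real.exp_zero, mul_one] at this
  rw [← this, mul_assoc, ← Real.exp_add]
  simp

theorem mem_G_of_symp (m : ℕ) (ψ : Matrix (Fin (2 * m) ⊕ Fin 2) (Fin (2 * m) ⊕ Fin 2) ℝ)
    (hs : ψᵀ * Kfull m * ψ = Kfull m) (α : ℝ) (hα : 0 < α)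
    (hrow : ∀ j, ψ (Sum.inr 0) j = if j = Sum.inr 0 then α else 0) : ψ ∈ GSet m := by
  have hinv : (-(Kfull m * ψᵀ * Kfull m)) * ψ = 1 := by
    have : (-(Kfull m * ψᵀ * Kfull m)) * ψ = -(Kfull m * (ψᵀ * Kfull m * ψ)) := by
      noncomm_ring
    rw [this, hs, Kfull_sq, neg_neg]
  have hinv2 := mul_eq_one_comm.mp hinv
  have hs2 : ψ * Kfull m * ψᵀ = Kfull m := by
    have h := congrArg (fun Z => Z * Kfull m) hinv2
    have e : ψ * -(Kfull m * ψᵀ * Kfull m) * Kfull m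
        = -(ψ * Kfull m * ψᵀ * (Kfull m * Kfull m)) := by noncomm_ring
    simp only [e, Kfull_sq] at h
    simpa using h
  have hcol : ∀ i, ψ i (Sum.inr 1) = if i = Sum.inr 1 then α⁻¹ else 0 := by
    intro i
    have h := congrFun (congrFun hs2 i) (Sum.inr 0)
    rw [Matrix.mul_apply] at h
    simp only [Matrix.transpose_apply, hrow] at h
    simp only [mul_ite, mul_zero, Finset.sum_ite_eq', Finset.mem_univ, if_true] at h
    have h2 : (ψ * Kfull m) i (Sum.inr 0) = ψ i (Sum.inr 1) := by
      simp [Matrix.mul_apply, Kfull]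
    rw [h2] at h
    rw [← mul_inv_cancel_right₀ hα.ne' (ψ i (Sum.inr 1)), h]
    rcases i with i | i
    · simp [Kfull]
    · fin_cases i <;> simp [Kfull]
  obtain ⟨X, Y, hXY⟩ := exists_interleave m (fun i => ψ (Sum.inl i) (Sum.inr 0))
  obtain ⟨U, V, hUV⟩ := exists_interleave m (fun i => ψ (Sum.inr 1) (Sum.inl i))
  have hψ : ψ = Matrix.fromBlocks ψ.toBlocks₁₁ (colB m (interleave m X Y))
      (rowC m (interleave m U V)) !![α, 0; ψ (Sum.inr 1) (Sum.inr 0), α⁻¹] := by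
    rw [← hXY, ← hUV]
    ext i j
    rcases i with i | i <;> rcases j with j | j
    · rfl
    · fin_cases j <;> simp [colB, hcol]
    · fin_cases i <;> simp [rowC, hrow]
    · fin_cases i <;> fin_cases j <;> simp [hrow, hcol]
  refine ⟨ψ.toBlocks₁₁, X, Y, U, V, α, ψ (Sum.inr 1) (Sum.inr 0), ?_, hα, ?_, hψ⟩
  all_goals
    rw [hψ] at hs
    unfold Kfull at hs
    rw [Matrix.fromBlocks_transpose, Matrix.fromBlocks_multiply, Matrix.fromBlocks_multiply,
      Matrix.fromBlocks_inj] at hs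
    obtain ⟨h11, -, h21, -⟩ := hs
    simp only [Matrix.mul_zero, Matrix.zero_mul, add_zero, zero_add] at h11 h21
  · have e : (rowC m (interleave m U V))ᵀ * (!![0, -1; 1, 0] : Matrix (Fin 2) (Fin 2) ℝ)
        * rowC m (interleave m U V) = 0 := by
      ext i j
      simp [Matrix.mul_apply, rowC]
    rw [e, add_zero] at h11
    exact h11
  · funext j
    have h := congrFun (congrFun h21 0) j
    have e1 : ∀ i, ((colB m (interleave m X Y))ᵀ * Jstd m) 0 i
        = - interleave m (fun t => - Y t) X i := by
      intro i
      rw [← Jstd_interleave, ← Jstd_mulVec, ← Finset.sum_neg_distrib, Matrix.mul_apply]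
      refine Finset.sum_congr rfl fun k _ => ?_
      have := congrFun (congrFun (Jstd_transpose m) i) k
      simp only [Matrix.transpose_apply, Matrix.neg_apply] at this
      rw [this]
      simp [colB]
      ring
    rw [Matrix.add_apply, Matrix.mul_apply] at h
    simp only [e1] at h
    simp [Matrix.mul_apply, rowC, Matrix.vecMul, dotProduct] at h ⊢
    linarith

/-- Solutions of a linear ODE with coefficients in `𝔤` stay in the group `G`: if `A` is
continuous (entrywise) with `A(t) ∈ 𝔤` for all `t`, `ψ(0) = I` and `ψ'(t) = A(t)·ψ(t)`
(entrywise derivative), then `ψ(t) ∈ G` for every `t ∈ ℝ`. -/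
theorem ode_solution_stays_in_G (n : ℕ) (hn : 2 ≤ n)
    (A ψ : ℝ → Matrix (Fin (2 * (n - 1)) ⊕ Fin 2) (Fin (2 * (n - 1)) ⊕ Fin 2) ℝ)
    (hAc : ∀ i j, Continuous fun t => A t i j)
    (hAg : ∀ t, A t ∈ gSet (n - 1))
    (hψ0 : ψ 0 = 1)
    (hderiv : ∀ (t : ℝ) i j, HasDerivAt (fun s => ψ s i j) ((A t * ψ t) i j) t) :
    ∀ t : ℝ, ψ t ∈ GSet (n - 1) := by
  intro t
  have hs := symp_preserved (Kfull (n - 1)) A ψ (fun t => g_infinitesimal _ _ (hAg t)) hψ0 hderiv t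
  have hrow : ∀ t j, A t (Sum.inr 0) j
      = if j = Sum.inr 0 then A t (Sum.inr 0) (Sum.inr 0) else 0 := by
    intro t j
    obtain ⟨R, X, Y, a, b, hR, hA⟩ := hAg t
    rw [hA]
    rcases j with j | j
    · simp [rowC]
    · fin_cases j <;> simp
  have hode : ∀ j t, HasDerivAt (fun s => ψ s (Sum.inr 0) j)
      (A t (Sum.inr 0) (Sum.inr 0) * ψ t (Sum.inr 0) j) t := by
    intro j t
    have h := hderiv t (Sum.inr 0) j
    have e : (A t * ψ t) (Sum.inr 0) j
        = A t (Sum.inr 0) (Sum.inr 0) * ψ t (Sum.inr 0) j := by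
      rw [Matrix.mul_apply, Finset.sum_eq_single (Sum.inr 0)]
      · intro k _ hk
        rw [hrow t k, if_neg hk, zero_mul]
      · simp
    rwa [e] at h
  refine mem_G_of_symp _ _ hs
    (Real.exp (∫ s in (0 : ℝ)..t, A s (Sum.inr 0) (Sum.inr 0))) (Real.exp_pos _) fun j => ?_
  rw [scalar_ode _ _ (hAc (Sum.inr 0) (Sum.inr 0)) (hode j) t, hψ0]
  by_cases hj : j = Sum.inr 0
  · subst hj; simp
  · simp [hj, Matrix.one_apply, Ne.symm hj]
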